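/- For every finite connected simple port-labeled graph G with n vertices, every root vertex v_R, and every integer k with 1 ≤ k ≤ n, the tree T of parent edges of the k-stopped port-DFS traversal is a DFS spanning tree of G[V']: every edge of the induced subgraph G[V'] that is not an edge of T joins two vertices u and w such that u lies on the unique path in T from v_R to w, or w lies on the unique path in T from v_R to u (i.e., one endpoint is an ancestor of the other in T rooted at v_R). -/

import Mathlib

open scoped Classical

/-- Direction of a move of the port-DFS traversal. -/
inductive PDir : Type where
  | fwd : PDir
  | bwd : PDir
deriving DecidableEq

/-- Position of the port-DFS walk: before the first move (`start`, at the root),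
having just arrived at `cur` via in-port `inPort` with direction `dir` (`moving`),
or halted at a vertex. -/
inductive PPos (V : Type) : Type where
  | start : PPos V
  | moving : V → ℕ → PDir → PPos V
  | halted : V → PPos V

/-- Full state of the port-DFS traversal: position, set `S` of visited vertices,
and parent-port assignment `par`. -/
structure PState (V : Type) : Type where
  pos : PPos V
  vis : Finset V
  par : V → ℕ

/-- A finite connected simple port-labeled graph: for every vertex `u` of degree
`deg u`, the edges incident to `u` are labeled by distinct ports `0, …, deg u - 1`;
`port u v` is the port at `u` of the edge `{u, v}`. -/
structure PortedGraph (V : Type) [Fintype V] [DecidableEq V] : Type where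
  G : SimpleGraph V
  conn : G.Connected
  deg : V → ℕ
  port : V → V → ℕ
  port_lt : ∀ {u v : V}, G.Adj u v → port u v < deg u
  port_inj : ∀ {u v w : V}, G.Adj u v → G.Adj u w → port u v = port u w → v = w
  port_surj : ∀ {u : V} (p : ℕ), p < deg u → ∃ v : V, G.Adj u v ∧ port u v = p

namespace PortedGraph

variable {V : Type} [Fintype V] [DecidableEq V]

/-- The neighbor of `u` reached from `u` through port `p`. -/
noncomputable def dest (P : PortedGraph V) (u : V) (p : ℕ) : V :=
  if h : ∃ v : V, P.G.Adj u v ∧ P.port u v = p then h.choose else u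

/-- One step of the port-DFS traversal from root `vR`.  A state with
`pos = moving v q d` means the walk has just arrived at `v` via port `q` (at `v`)
with direction `d`, and `vis`/`par` are the data from before processing this
arrival; the step processes the arrival according to rules (i)–(v) and performs
the next move (or halts). -/
noncomputable def step (P : PortedGraph V) (vR : V) (s : PState V) : PState V :=
  match s.pos with
  | PPos.start =>
      if 0 < P.deg vR then
        { pos := PPos.moving (P.dest vR 0) (P.port (P.dest vR 0) vR) PDir.fwd,
          vis := s.vis, par := s.par }
      else
        { pos := PPos.halted vR, vis := s.vis, par := s.par }
  | PPos.halted v => { pos := PPos.halted v, vis := s.vis, par := s.par }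
  | PPos.moving v q PDir.fwd =>
      if v ∈ s.vis then
        -- rule (ii): leave via `q` with direction backward
        { pos := PPos.moving (P.dest v q) (P.port (P.dest v q) v) PDir.bwd,
          vis := s.vis, par := s.par }
      else
        -- rule (i): add `v` to `S`, set `par v := q`, leave via `(q+1) % deg v`
        { pos := PPos.moving (P.dest v ((q + 1) % P.deg v))
            (P.port (P.dest v ((q + 1) % P.deg v)) v)
            (if (q + 1) % P.deg v = q then PDir.bwd else PDir.fwd),
          vis := insert v s.vis, par := Function.update s.par v q }
  | PPos.moving v q PDir.bwd =>
      if v ≠ vR ∧ (q + 1) % P.deg v = s.par v then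
        -- rule (iii): leave via the parent port with direction backward
        { pos := PPos.moving (P.dest v (s.par v)) (P.port (P.dest v (s.par v)) v) PDir.bwd,
          vis := s.vis, par := s.par }
      else if v = vR ∧ (q + 1) % P.deg v = 0 then
        -- rule (iv): halt
        { pos := PPos.halted v, vis := s.vis, par := s.par }
      else
        -- rule (v): leave via `(q+1) % deg v` with direction forward
        { pos := PPos.moving (P.dest v ((q + 1) % P.deg v))
            (P.port (P.dest v ((q + 1) % P.deg v)) v) PDir.fwd,
          vis := s.vis, par := s.par }

/-- The trace of the port-DFS traversal from `vR`:  `trace P vR t` is the state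
after `t` transitions; every transition except those into/out of a halted
position is a move along an edge. -/
noncomputable def trace (P : PortedGraph V) (vR : V) : ℕ → PState V
  | 0 => { pos := PPos.start, vis := {vR}, par := fun _ => 0 }
  | t + 1 => P.step vR (P.trace vR t)

/-- The first time at which `k` distinct vertices have been visited; the
`k`-stopped traversal is the traversal halted at that moment (at which point the
walk, having made `stopTime - 1` moves, stands at the `k`-th visited vertex). -/
noncomputable def stopTime (P : PortedGraph V) (vR : V) (k : ℕ) : ℕ :=
  sInf {t : ℕ | k ≤ ((P.trace vR t).vis).card}

/-- `V'`: the set of vertices visited by the `k`-stopped traversal. -/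
noncomputable def visitedBy (P : PortedGraph V) (vR : V) (k : ℕ) : Finset V :=
  (P.trace vR (P.stopTime vR k)).vis

/-- `V'` as a set. -/
noncomputable def Vset (P : PortedGraph V) (vR : V) (k : ℕ) : Set V :=
  ↑(P.visitedBy vR k)

/-- The parent-port assignment at the end of the `k`-stopped traversal. -/
noncomputable def parFinal (P : PortedGraph V) (vR : V) (k : ℕ) : V → ℕ :=
  (P.trace vR (P.stopTime vR k)).par

/-- `u(v)`: the neighbor of `v` reached from `v` through its parent port. -/
noncomputable def parentVert (P : PortedGraph V) (vR : V) (k : ℕ) (v : V) : V :=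
  P.dest v (P.parFinal vR k v)

/-- `v_L`: the `k`-th (last) vertex added to `S` by the `k`-stopped traversal. -/
noncomputable def lastVert (P : PortedGraph V) (vR : V) (k : ℕ) : V :=
  if h : ∃ v : V, v ∈ P.visitedBy vR k ∧ v ∉ (P.trace vR (P.stopTime vR k - 1)).vis
  then h.choose else vR

/-- The tree `T` of parent edges `{v, u(v)}`, `v ∈ V' \ {v_R}`, as a graph on `V`
(vertices outside `V'` are isolated). -/
noncomputable def treeRel (P : PortedGraph V) (vR : V) (k : ℕ) : SimpleGraph V :=
  SimpleGraph.fromRel (fun a b =>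
    a ∈ P.visitedBy vR k ∧ a ≠ vR ∧ b = P.parentVert vR k a)

/-- The tree `T` of parent edges as a graph on the vertex set `V'`. -/
noncomputable def treeSub (P : PortedGraph V) (vR : V) (k : ℕ) :
    SimpleGraph (P.Vset vR k) :=
  SimpleGraph.fromRel (fun a b => (a : V) ≠ vR ∧ (b : V) = P.parentVert vR k (a : V))

/-- `v` lies on the rootpath: the unique path in `T` from `v_R` to `v_L`. -/
def onRootpath (P : PortedGraph V) (vR : V) (k : ℕ) (v : V) : Prop :=
  ∃ p : (P.treeRel vR k).Walk vR (P.lastVert vR k), p.IsPath ∧ v ∈ p.support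

/-- The move made out of state `s`:  `some (v, p, d)` if the walk leaves vertex
`v` via port `p` with direction `d`, and `none` if it halts (or already halted). -/
noncomputable def exitEvent (P : PortedGraph V) (vR : V) (s : PState V) :
    Option (V × ℕ × PDir) :=
  match s.pos with
  | PPos.start => if 0 < P.deg vR then some (vR, 0, PDir.fwd) else none
  | PPos.halted _ => none
  | PPos.moving v q PDir.fwd =>
      if v ∈ s.vis then some (v, q, PDir.bwd)
      else some (v, (q + 1) % P.deg v,
        if (q + 1) % P.deg v = q then PDir.bwd else PDir.fwd)
  | PPos.moving v q PDir.bwd =>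
      if v ≠ vR ∧ (q + 1) % P.deg v = s.par v then some (v, s.par v, PDir.bwd)
      else if v = vR ∧ (q + 1) % P.deg v = 0 then none
      else some (v, (q + 1) % P.deg v, PDir.fwd)

end PortedGraph

namespace SimpleGraph

variable {W : Type*} {R : W → W → Prop} {r : W}

/-- A functional relation along which a rank strictly decreases, and which is defined everywhere
except at `r`, spans a tree. -/
theorem isTree_fromRel_of_rank (rank : W → ℕ)
    (hfun : ∀ a b c, R a b → R a c → b = c)
    (hrank : ∀ a b, R a b → rank b < rank a)
    (hex : ∀ a, a ≠ r → ∃ b, R a b) :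
    (fromRel R).IsTree := by
  have hreach : ∀ n a, rank a = n → (fromRel R).Reachable a r := by
    intro n
    induction n using Nat.strong_induction_on with
    | _ n ih =>
      intro a ha
      by_cases har : a = r
      · rw [har]
      · obtain ⟨b, hb⟩ := hex a har
        have hlt := hrank a b hb
        have hadj : (fromRel R).Adj a b := by
          rw [fromRel_adj]
          exact ⟨fun h => by subst h; omega, Or.inl hb⟩
        exact hadj.reachable.trans (ih (rank b) (ha ▸ hlt) b rfl)
  have : Nonempty W := ⟨r⟩
  refine ⟨⟨fun a b => (hreach _ a rfl).trans (hreach _ b rfl).symm⟩, ?_⟩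
  intro v c hc
  obtain ⟨w, hw, hmax⟩ := c.support.toFinset.exists_max_image rank
    ⟨v, by simp⟩
  simp only [List.mem_toFinset] at hw hmax
  have hd := hc.rotate hw
  have hmem : ∀ x ∈ (c.rotate w hw).support, rank x ≤ rank w := fun x hx =>
    hmax x ((c.mem_support_rotate_iff w hw).1 hx)
  have key : ∀ x ∈ (c.rotate w hw).support, (fromRel R).Adj w x → R w x := by
    intro x hx hadj
    rw [fromRel_adj] at hadj
    rcases hadj.2 with h | h
    · exact h
    · exact absurd (hrank _ _ h) (not_lt.2 (hmem x hx))
  refine hd.snd_ne_penultimate (hfun w _ _ (key _ ?_ ?_) (key _ ?_ ?_))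
  · exact Walk.getVert_mem_support _ _
  · exact Walk.adj_snd hd.not_nil
  · exact Walk.getVert_mem_support _ _
  · exact (Walk.adj_penultimate hd.not_nil).symm

/-- A walk ending at a descendant of `a` either starts at one or passes through `a`. -/
theorem reflTransGen_or_mem_support_of_walk
    (hfun : ∀ a b c, R a b → R a c → b = c) {a u b : W}
    (p : (fromRel R).Walk u b) (hb : Relation.ReflTransGen R b a) :
    Relation.ReflTransGen R u a ∨ a ∈ p.support := by
  induction p with
  | nil => exact Or.inl hb
  | @cons u w b h p ih =>
    rcases ih hb with hw | hw
    · rw [fromRel_adj] at h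
      rcases h.2 with huw | hwu
      · exact Or.inl (hw.head huw)
      · rcases hw.cases_head with rfl | ⟨c, hwc, hca⟩
        · exact Or.inr (by simp)
        · exact Or.inl (hfun _ _ _ hwu hwc ▸ hca)
    · exact Or.inr (by simp [hw])

theorem mem_support_of_reflTransGen
    (hfun : ∀ a b c, R a b → R a c → b = c) (hroot : ∀ b, ¬ R r b) {a b : W}
    (p : (fromRel R).Walk r b) (hb : Relation.ReflTransGen R b a) : a ∈ p.support := by
  rcases reflTransGen_or_mem_support_of_walk hfun p hb with h | h
  · rcases h.cases_head with rfl | ⟨c, hc, -⟩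
    · simp
    · exact absurd hc (hroot c)
  · exact h

end SimpleGraph

namespace PortedGraph

variable {V : Type} [Fintype V] [DecidableEq V] (P : PortedGraph V)

theorem dest_spec {u : V} {p : ℕ} (hp : p < P.deg u) :
    P.G.Adj u (P.dest u p) ∧ P.port u (P.dest u p) = p := by
  unfold dest
  rw [dif_pos (P.port_surj p hp)]
  exact (P.port_surj p hp).choose_spec

theorem dest_port {u v : V} (h : P.G.Adj u v) : P.dest u (P.port u v) = v :=
  have hs := P.dest_spec (P.port_lt h)
  P.port_inj hs.1 h hs.2

/-- The ports of `x` cyclically from `c` up to, but excluding, `p` lead into `vis`. -/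
def Explored (vis : Finset V) (x : V) (c p : ℕ) : Prop :=
  ∃ m, p = (c + m) % P.deg x ∧ ∀ i < m, P.dest x ((c + i) % P.deg x) ∈ vis

variable {P} {vR : V} {vis vis' : Finset V} {par par' : V → ℕ}

theorem Explored.mono {x : V} {c p : ℕ} (h : P.Explored vis x c p) (hs : vis ⊆ vis') :
    P.Explored vis' x c p :=
  let ⟨m, hm, hi⟩ := h
  ⟨m, hm, fun i him => hs (hi i him)⟩

theorem Explored.succ {x : V} {c p : ℕ} (h : P.Explored vis x c p) (hp : P.dest x p ∈ vis) :
    P.Explored vis x c ((p + 1) % P.deg x) := by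
  obtain ⟨m, rfl, hi⟩ := h
  refine ⟨m + 1, by simp [Nat.add_assoc], fun i him => ?_⟩
  rcases Nat.lt_succ_iff_lt_or_eq.1 him with h | rfl
  · exact hi i h
  · exact hp

theorem explored_self {x : V} {c : ℕ} (hc : c < P.deg x) : P.Explored vis x c c :=
  ⟨0, by simp [Nat.mod_eq_of_lt hc], by simp⟩

/-- Once the exploration has gone all the way around, all neighbors are visited. -/
theorem Explored.complete {x : V} {c p : ℕ} (h : P.Explored vis x c p)
    (hp : P.dest x p ∈ vis) (hcp : (p + 1) % P.deg x = c) {y : V} (hy : P.G.Adj x y) :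
    y ∈ vis := by
  have hport := P.port_lt hy
  have hpos : 0 < P.deg x := by omega
  have hc : c < P.deg x := hcp ▸ Nat.mod_lt _ hpos
  obtain ⟨m, rfl, hi⟩ := h
  have hdvd : P.deg x ∣ m + 1 := by
    have h1 : c + (m + 1) ≡ c + 0 [MOD P.deg x] := by
      unfold Nat.ModEq
      rw [Nat.mod_add_mod] at hcp
      rw [← Nat.add_assoc, hcp, Nat.add_zero, Nat.mod_eq_of_lt hc]
    exact (Nat.modEq_zero_iff_dvd).1 (Nat.ModEq.add_left_cancel' c h1)
  have hle := Nat.le_of_dvd (Nat.succ_pos m) hdvd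
  obtain ⟨i, him, hie⟩ : ∃ i < P.deg x, (c + i) % P.deg x = P.port x y := by
    rcases le_or_gt c (P.port x y) with hcy | hcy
    · refine ⟨P.port x y - c, by omega, ?_⟩
      rw [Nat.add_sub_cancel' hcy, Nat.mod_eq_of_lt hport]
    · refine ⟨P.port x y + P.deg x - c, by omega, ?_⟩
      rw [Nat.add_sub_cancel' (by omega), Nat.add_mod_right, Nat.mod_eq_of_lt hport]
  rw [← P.dest_port hy, ← hie]
  rcases Nat.lt_or_ge i m with h | h
  · exact hi i h
  · obtain rfl : i = m := by omega
    exact hp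

variable (P vR) in
/-- `y` is the parent of the visited non-root vertex `x`. -/
def IsParent (vis : Finset V) (par : V → ℕ) (x y : V) : Prop :=
  x ∈ vis ∧ x ≠ vR ∧ y = P.dest x (par x)

theorem IsParent.mono (hs : vis ⊆ vis') (hpar : ∀ x ∈ vis, par' x = par x) (x y : V)
    (h : P.IsParent vR vis par x y) : P.IsParent vR vis' par' x y :=
  ⟨hs h.1, h.2.1, by rw [hpar x h.1]; exact h.2.2⟩

variable (P vR) in
/-- The path of vertices under exploration, from the current vertex down to the root. -/
inductive IsStack (vis : Finset V) (par : V → ℕ) : List V → Prop where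
  | root : IsStack vis par [vR]
  | push (x y : V) (l : List V) : IsStack vis par (y :: l) → y ∈ vis →
      P.IsParent vR vis par x y → P.G.Adj x y → P.Explored vis y (par y) (P.port y x) →
      IsStack vis par (x :: y :: l)

theorem IsStack.mono {l : List V} (h : P.IsStack vR vis par l) (hs : vis ⊆ vis')
    (hpar : ∀ x ∈ vis, par' x = par x) : P.IsStack vR vis' par' l := by
  induction h with
  | root => exact .root
  | push x y l _ hy hxy hadj hexp ih =>
    exact .push x y l ih (hs hy) (hxy.mono hs hpar) hadj (hpar y hy ▸ hexp.mono hs)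

theorem IsStack.ancestor {l : List V} (h : P.IsStack vR vis par l) :
    ∀ u ∈ l.head?, ∀ b ∈ l, Relation.ReflTransGen (P.IsParent vR vis par) u b := by
  induction h with
  | root => simp [Relation.ReflTransGen.refl]
  | push x y l _ hy hxy hadj hexp ih =>
    intro u hu b hb
    obtain rfl : x = u := by simpa using hu
    rcases List.mem_cons.1 hb with rfl | hb
    · exact .refl
    · exact (ih y (by simp) b hb).head hxy

theorem IsStack.head_mem {u : V} {l : List V} (h : P.IsStack vR vis par (u :: l))
    (hR : vR ∈ vis) : u ∈ vis := by
  cases h with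
  | root => exact hR
  | push x y l _ hy hxy => exact hxy.1

variable (P vR) in
/-- Consistency of the position of the walk with the stack. -/
def PosOK (vis : Finset V) (par : V → ℕ) : PPos V → Prop
  | PPos.start => ∀ x ∈ vis, x = vR
  | PPos.halted _ => True
  | PPos.moving v q PDir.bwd => ∃ l, P.IsStack vR vis par (v :: l) ∧
      P.Explored vis v (par v) q ∧ q < P.deg v ∧ P.dest v q ∈ vis ∧
      ∀ x ∈ vis, x ∉ v :: l → ∀ y, P.G.Adj x y → y ∈ vis
  | PPos.moving v q PDir.fwd => ∃ u l, P.IsStack vR vis par (u :: l) ∧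
      P.G.Adj u v ∧ q = P.port v u ∧ P.Explored vis u (par u) (P.port u v) ∧
      ∀ x ∈ vis, x ∉ u :: l → ∀ y, P.G.Adj x y → y ∈ vis

variable (P vR) in
/-- The parent pointers form a depth-first search tree on the visited vertices. -/
structure TreeOK (vis : Finset V) (par : V → ℕ) : Prop where
  root_mem : vR ∈ vis
  par_root : par vR = 0
  par_lt : ∀ v ∈ vis, v ≠ vR → par v < P.deg v
  par_mem : ∀ v ∈ vis, v ≠ vR → P.dest v (par v) ∈ vis
  rank : ∃ rank : V → ℕ, ∀ v ∈ vis, v ≠ vR → rank (P.dest v (par v)) < rank v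
  comparable : ∀ a ∈ vis, ∀ b ∈ vis, P.G.Adj a b →
    Relation.ReflTransGen (P.IsParent vR vis par) a b ∨
    Relation.ReflTransGen (P.IsParent vR vis par) b a

theorem TreeOK.insert (h : P.TreeOK vR vis par) {u v : V} {l : List V} (hv : v ∉ vis)
    (hst : P.IsStack vR vis par (u :: l)) (hadj : P.G.Adj u v)
    (hdone : ∀ x ∈ vis, x ∉ u :: l → ∀ y, P.G.Adj x y → y ∈ vis) :
    P.TreeOK vR (insert v vis) (Function.update par v (P.port v u)) := by
  have hu : u ∈ vis := hst.head_mem h.root_mem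
  have hvR : vR ≠ v := fun e => hv (e ▸ h.root_mem)
  have hs : vis ⊆ Insert.insert v vis := Finset.subset_insert v vis
  have hne : ∀ x ∈ vis, x ≠ v := fun x hx e => hv (e ▸ hx)
  have hpar : ∀ x ∈ vis, Function.update par v (P.port v u) x = par x := fun x hx =>
    Function.update_of_ne (hne x hx) _ _
  have hdest : P.dest v (P.port v u) = u := P.dest_port hadj.symm
  have hmono : ∀ {a b : V}, Relation.ReflTransGen (P.IsParent vR vis par) a b →
      Relation.ReflTransGen (P.IsParent vR (Insert.insert v vis)
        (Function.update par v (P.port v u))) a b :=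
    fun hab => Relation.ReflTransGen.mono (IsParent.mono hs hpar) _ _ hab
  have hnew : ∀ b ∈ vis, P.G.Adj v b →
      Relation.ReflTransGen (P.IsParent vR (Insert.insert v vis)
        (Function.update par v (P.port v u))) v b := by
    intro b hb hvb
    have hbl : b ∈ u :: l := by
      by_contra hbl
      exact hv (hdone b hb hbl v hvb.symm)
    refine (hmono (hst.ancestor u (by simp) b hbl)).head
      ⟨Finset.mem_insert_self v vis, hvR.symm, ?_⟩
    rw [Function.update_self, hdest]
  refine ⟨hs h.root_mem, ?_, ?_, ?_, ?_, ?_⟩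
  · rw [hpar _ h.root_mem, h.par_root]
  · intro x hx hxR
    rcases Finset.mem_insert.1 hx with rfl | hx
    · rw [Function.update_self]
      exact P.port_lt hadj.symm
    · rw [hpar x hx]
      exact h.par_lt x hx hxR
  · intro x hx hxR
    rcases Finset.mem_insert.1 hx with rfl | hx
    · rw [Function.update_self, hdest]
      exact hs hu
    · rw [hpar x hx]
      exact hs (h.par_mem x hx hxR)
  · obtain ⟨rank, hrank⟩ := h.rank
    refine ⟨Function.update rank v (rank u + 1), fun x hx hxR => ?_⟩
    rcases Finset.mem_insert.1 hx with rfl | hx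
    · rw [Function.update_self, Function.update_self, hdest, Function.update_of_ne (hne u hu)]
      exact Nat.lt_succ_self _
    · rw [hpar x hx, Function.update_of_ne (hne x hx),
        Function.update_of_ne (hne _ (h.par_mem x hx hxR))]
      exact hrank x hx hxR
  · intro a ha b hb hab
    rcases Finset.mem_insert.1 ha with rfl | ha'
    · rcases Finset.mem_insert.1 hb with rfl | hb'
      · exact absurd hab P.G.irrefl
      · exact Or.inl (hnew b hb' hab)
    · rcases Finset.mem_insert.1 hb with rfl | hb'
      · exact Or.inr (hnew a ha' hab.symm)
      · exact (h.comparable a ha' b hb' hab).imp hmono hmono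

/-- Leaving the top of the stack forward through port `p`. -/
theorem posOK_fwd {u : V} {l : List V} {p : ℕ} (hst : P.IsStack vR vis par (u :: l))
    (hp : p < P.deg u) (hexp : P.Explored vis u (par u) p)
    (hdone : ∀ x ∈ vis, x ∉ u :: l → ∀ y, P.G.Adj x y → y ∈ vis) :
    P.PosOK vR vis par
      (PPos.moving (P.dest u p) (P.port (P.dest u p) u) PDir.fwd) := by
  have hs := P.dest_spec hp
  exact ⟨u, l, hst, hs.1, rfl, by rwa [hs.2], hdone⟩

/-- Returning backward to the top `u` of the stack from a visited neighbor `v`. -/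
theorem posOK_bwd {u v : V} {l : List V} (hst : P.IsStack vR vis par (u :: l))
    (hadj : P.G.Adj u v) (hv : v ∈ vis) (hexp : P.Explored vis u (par u) (P.port u v))
    (hdone : ∀ x ∈ vis, x ∉ u :: l → ∀ y, P.G.Adj x y → y ∈ vis) :
    P.PosOK vR vis par (PPos.moving u (P.port u v) PDir.bwd) :=
  ⟨l, hst, hexp, P.port_lt hadj, by rwa [P.dest_port hadj], hdone⟩

variable (P vR) in
/-- The invariant of the traversal. -/
def Invariant (s : PState V) : Prop :=
  P.TreeOK vR s.vis s.par ∧ P.PosOK vR s.vis s.par s.pos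

theorem Invariant.step {s : PState V} (h : P.Invariant vR s) :
    P.Invariant vR (P.step vR s) := by
  obtain ⟨pos, vis, par⟩ := s
  obtain ⟨ht, hpos⟩ := h
  dsimp only at ht hpos
  match pos, hpos with
  | PPos.start, hpos =>
    by_cases hd : 0 < P.deg vR
    · simp only [PortedGraph.step, if_pos hd]
      refine ⟨ht, posOK_fwd (IsStack.root) hd ?_ ?_⟩
      · dsimp only
        rw [ht.par_root]
        exact explored_self hd
      · intro x hx hxR
        exact absurd (hpos x hx) (by simpa using hxR)
    · simp only [PortedGraph.step, if_neg hd]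
      exact ⟨ht, trivial⟩
  | PPos.halted v, _ => exact ⟨ht, trivial⟩
  | PPos.moving v q PDir.fwd, ⟨u, l, hst, hadj, hq, hexp, hdone⟩ =>
    have hdest : P.dest v q = u := hq ▸ P.dest_port hadj.symm
    by_cases hv : v ∈ vis
    · simp only [PortedGraph.step, if_pos hv]
      rw [hdest]
      exact ⟨ht, posOK_bwd hst hadj hv hexp hdone⟩
    · simp only [PortedGraph.step, if_neg hv]
      have ht' := ht.insert hv hst hadj hdone
      rw [← hq] at ht'
      refine ⟨ht', ?_⟩
      have hu : u ∈ vis := hst.head_mem ht.root_mem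
      have hvR : v ≠ vR := fun e => hv (e ▸ ht.root_mem)
      have hs : vis ⊆ insert v vis := Finset.subset_insert v vis
      have hpar : ∀ x ∈ vis, Function.update par v q x = par x := fun x hx =>
        Function.update_of_ne (fun e : x = v => hv (e ▸ hx)) _ _
      have hqlt : q < P.deg v := hq ▸ P.port_lt hadj.symm
      have hself : Function.update par v q v = q := Function.update_self ..
      have hst' := hst.mono hs hpar
      have hexp' : P.Explored (insert v vis) u (Function.update par v q u) (P.port u v) :=
        hpar u hu ▸ hexp.mono hs
      have hvexp : P.Explored (insert v vis) v (Function.update par v q v) q :=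
        hself.symm ▸ explored_self hqlt
      have hdmem : P.dest v q ∈ insert v vis := hdest ▸ hs hu
      have hdone' : ∀ x ∈ insert v vis, x ≠ v → x ∉ u :: l →
          ∀ y, P.G.Adj x y → y ∈ insert v vis := fun x hx hxv hxl y hxy =>
        hs (hdone x (Finset.mem_of_mem_insert_of_ne hx hxv) hxl y hxy)
      by_cases hlast : (q + 1) % P.deg v = q
      · simp only [hlast, if_true]
        rw [hdest]
        refine posOK_bwd hst' hadj (Finset.mem_insert_self v vis) hexp' fun x hx hxl y hxy => ?_
        by_cases hxv : x = v
        · subst hxv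
          exact hvexp.complete hdmem (hlast.trans hself.symm) hxy
        · exact hdone' x hx hxv hxl y hxy
      · simp only [if_neg hlast]
        refine posOK_fwd (l := u :: l)
          (.push v u l hst' (hs hu) ⟨Finset.mem_insert_self v vis, hvR, ?_⟩ hadj.symm hexp')
          (Nat.mod_lt _ (by omega)) (hvexp.succ hdmem) fun x hx hxl => ?_
        · rw [hself, hdest]
        · rw [List.mem_cons, not_or] at hxl
          exact hdone' x hx hxl.1 hxl.2
  | PPos.moving v q PDir.bwd, ⟨l, hst, hexp, hqlt, hq, hdone⟩ =>
    by_cases h3 : v ≠ vR ∧ (q + 1) % P.deg v = par v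
    · simp only [PortedGraph.step, if_pos h3]
      refine ⟨ht, ?_⟩
      cases hst with
      | root => exact absurd rfl h3.1
      | push _ y l hst hy hvy hadj hyexp =>
        rw [← hvy.2.2]
        refine posOK_bwd hst hadj.symm hvy.1 hyexp fun x hx hxl z hxz => ?_
        by_cases hxv : x = v
        · subst hxv
          exact hexp.complete hq h3.2 hxz
        · exact hdone x hx (by rw [List.mem_cons, not_or]; exact ⟨hxv, hxl⟩) z hxz
    · by_cases h4 : v = vR ∧ (q + 1) % P.deg v = 0
      · simp only [PortedGraph.step, if_neg h3, if_pos h4]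
        exact ⟨ht, trivial⟩
      · simp only [PortedGraph.step, if_neg h3, if_neg h4]
        exact ⟨ht, posOK_fwd hst (Nat.mod_lt _ (by omega)) (hexp.succ hq) hdone⟩

variable (P vR) in
theorem invariant_trace (t : ℕ) : P.Invariant vR (P.trace vR t) := by
  induction t with
  | zero =>
    refine ⟨⟨by simp [trace], rfl, ?_, ?_, ⟨fun _ => 0, ?_⟩, ?_⟩, ?_⟩
    · simp +contextual [trace]
    · simp +contextual [trace]
    · simp +contextual [trace]
    · simp +contextual [trace]
    · exact fun x hx => Finset.mem_singleton.1 hx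
  | succ t ih => exact ih.step

end PortedGraph

/-- the tree `T` of parent edges is a DFS spanning tree of `G[V']`:
it is a spanning tree of `G[V']`, and every edge of `G[V']` that is not an edge
of `T` joins two vertices one of which is an ancestor of the other in `T` rooted
at `v_R` (i.e. lies on the unique path in `T` from `v_R` to the other). -/
theorem statement3 {V : Type} [Fintype V] [DecidableEq V]
    (P : PortedGraph V) (vR : V) (k : ℕ)
    (hk1 : 1 ≤ k) (hk2 : k ≤ Fintype.card V)
    (hvR : vR ∈ P.Vset vR k) :
    (P.treeSub vR k).IsTree ∧ P.treeSub vR k ≤ P.G.induce (P.Vset vR k) ∧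
    ∀ a b : P.Vset vR k,
      (P.G.induce (P.Vset vR k)).Adj a b → ¬ (P.treeSub vR k).Adj a b →
      ((∀ p : (P.treeSub vR k).Walk ⟨vR, hvR⟩ b, p.IsPath → a ∈ p.support) ∨
       (∀ p : (P.treeSub vR k).Walk ⟨vR, hvR⟩ a, p.IsPath → b ∈ p.support)) := by
  have ht : P.TreeOK vR (P.visitedBy vR k) (P.parFinal vR k) :=
    (P.invariant_trace vR (P.stopTime vR k)).1
  set R : P.Vset vR k → P.Vset vR k → Prop :=
    fun a b => (a : V) ≠ vR ∧ (b : V) = P.parentVert vR k (a : V) with hR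
  have hfun : ∀ a b c, R a b → R a c → b = c := fun a b c hb hc =>
    Subtype.ext (hb.2.trans hc.2.symm)
  have hroot : ∀ b, ¬ R ⟨vR, hvR⟩ b := fun b hb => hb.1 rfl
  have hlift : ∀ (x y : V), Relation.ReflTransGen
      (P.IsParent vR (P.visitedBy vR k) (P.parFinal vR k)) x y →
      ∀ (hx : x ∈ P.Vset vR k) (hy : y ∈ P.Vset vR k),
        Relation.ReflTransGen R ⟨x, hx⟩ ⟨y, hy⟩ := by
    intro x y hxy
    induction hxy using Relation.ReflTransGen.head_induction_on with
    | refl => exact fun _ _ => .refl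
    | @head x z hxz _ ih =>
      intro hx hy
      have hz : z ∈ P.Vset vR k := by
        rw [hxz.2.2]
        exact ht.par_mem x hxz.1 hxz.2.1
      exact (ih hz hy).head ⟨hxz.2.1, hxz.2.2⟩
  obtain ⟨rank, hrank⟩ := ht.rank
  refine ⟨?_, ?_, ?_⟩
  · refine SimpleGraph.isTree_fromRel_of_rank (r := ⟨vR, hvR⟩) (fun a => rank a) hfun ?_ ?_
    · rintro a b ⟨haR, hab⟩
      rw [hab]
      exact hrank a a.2 haR
    · intro a ha
      have haR : (a : V) ≠ vR := fun e => ha (Subtype.ext e)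
      exact ⟨⟨_, ht.par_mem a a.2 haR⟩, haR, rfl⟩
  · have hadj : ∀ a b : P.Vset vR k, R a b → P.G.Adj a b := fun a b hab => by
      rw [hab.2]
      exact (P.dest_spec (ht.par_lt a a.2 hab.1)).1
    intro a b hab
    rcases ((SimpleGraph.fromRel_adj _ _ _).1 hab).2 with h | h
    · exact hadj a b h
    · exact (hadj b a h).symm
  · intro a b hab _
    rcases ht.comparable a a.2 b b.2 hab with h | h
    · exact Or.inr fun p _ =>
        SimpleGraph.mem_support_of_reflTransGen hfun hroot p (hlift _ _ h a.2 b.2)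
    · exact Or.inl fun p _ =>
        SimpleGraph.mem_support_of_reflTransGen hfun hroot p (hlift _ _ h b.2 a.2)
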